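/- arXiv:2010.01221 — 3 statements merged into one kernel-verified Lean document; each statement's English description precedes it below -/
import Mathlib

section
/- Let ν be a Borel measure on ℝⁿ, let Q be a cube with 0 < ν(Q) < ∞ and let f ∈ L¹_loc(ℝⁿ, dν). For real numbers L < U define the truncation τ_{LU} f(x) := max{L, min{U, f(x)}}. Then (1/ν(Q)) ∫_Q |f − f_{Q,ν}| dν ≤ sup_{L < U} (1/ν(Q)) ∫_Q |τ_{LU} f − (τ_{LU} f)_{Q,ν}| dν ≤ (2/ν(Q)) ∫_Q |f − f_{Q,ν}| dν, where g_{Q,ν} := (1/ν(Q)) ∫_Q g dν. -/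
open MeasureTheory Set Filter
open scoped ENNReal

noncomputable section

/-- An axis-parallel cube in `ℝⁿ`, given by its lower corner and (positive) sidelength. -/
structure Cube (n : ℕ) where
  corner : Fin n → ℝ
  side : ℝ
  side_pos : 0 < side

/-- The set of points of a cube. -/
def Cube.carrier {n : ℕ} (Q : Cube n) : Set (Fin n → ℝ) :=
  {x | ∀ i, Q.corner i ≤ x i ∧ x i ≤ Q.corner i + Q.side}

/-- A Borel measure on `ℝⁿ` is doubling with doubling constant `c ≥ 1` and doubling
dimension `d > 0`: every cube has finite positive measure and
`μ(Q̃) ≤ c (ℓ(Q̃)/ℓ(Q))^d μ(Q)` whenever `Q ⊆ Q̃`. -/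
def IsDoubling {n : ℕ} (μ : Measure (Fin n → ℝ)) (c d : ℝ) : Prop :=
  1 ≤ c ∧ 0 < d ∧ (∀ Q : Cube n, 0 < μ Q.carrier ∧ μ Q.carrier < ⊤) ∧
    ∀ Q Q' : Cube n, Q.carrier ⊆ Q'.carrier →
      μ Q'.carrier ≤ ENNReal.ofReal (c * (Q'.side / Q.side) ^ d) * μ Q.carrier

/-- `f_{Q,μ}`, the `μ`-average of `f` over the cube `Q`. -/
def cubeAvg {n : ℕ} (μ : Measure (Fin n → ℝ)) (Q : Cube n) (f : (Fin n → ℝ) → ℝ) : ℝ :=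
  ⨍ x in Q.carrier, f x ∂μ

/-- The mean oscillation of `f` over the cube `Q`. -/
def osc {n : ℕ} (μ : Measure (Fin n → ℝ)) (Q : Cube n) (f : (Fin n → ℝ) → ℝ) : ℝ :=
  ⨍ x in Q.carrier, |f x - cubeAvg μ Q f| ∂μ

/-- The `BMO(dμ)` norm: supremum of the mean oscillations over all cubes. -/
def bmoNorm {n : ℕ} (μ : Measure (Fin n → ℝ)) (f : (Fin n → ℝ) → ℝ) : ℝ :=
  ⨆ Q : Cube n, osc μ Q f

/-- Membership in `BMO(dμ)`: local integrability together with a finite supremum of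
mean oscillations. -/
def MemBMO {n : ℕ} (μ : Measure (Fin n → ℝ)) (f : (Fin n → ℝ) → ℝ) : Prop :=
  LocallyIntegrable f μ ∧ BddAbove (Set.range fun Q : Cube n => osc μ Q f)

/-- The local Luxemburg norm `‖f‖_{φ(L)(Q, dν/ν(Q))}`. -/
def luxNorm {n : ℕ} (φ : ℝ → ℝ) (ν : Measure (Fin n → ℝ)) (Q : Cube n)
    (f : (Fin n → ℝ) → ℝ) : ℝ :=
  sInf {l : ℝ | 0 < l ∧
    ∫⁻ x in Q.carrier, ENNReal.ofReal (φ (|f x| / l)) ∂ν ≤ ν Q.carrier}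

/-- The local variable-exponent Luxemburg norm `‖f‖_{L^{p(·)}(Q, dx/|Q|)}`. -/
def vpLuxNorm {n : ℕ} (p : (Fin n → ℝ) → ℝ) (Q : Cube n) (f : (Fin n → ℝ) → ℝ) : ℝ :=
  sInf {l : ℝ | 0 < l ∧
    ∫⁻ x in Q.carrier, ENNReal.ofReal ((|f x| / l) ^ p x) ≤ volume Q.carrier}

theorem Cube.carrier_eq_Icc {n : ℕ} (Q : Cube n) :
    Q.carrier = Set.Icc Q.corner fun i => Q.corner i + Q.side := by
  ext x
  simp [Cube.carrier, Set.mem_Icc, Pi.le_def, forall_and]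

theorem abs_max_min_sub_max_min_le (L U a b : ℝ) :
    |max L (min U a) - max L (min U b)| ≤ |a - b| :=
  (abs_max_sub_max_le_max L _ L _).trans <| by
    simpa using (abs_min_sub_min_le_max U a U b)

/-- The mean deviation from the mean is at most twice the mean deviation from any constant. -/
theorem average_abs_sub_average_le {α : Type*} [MeasurableSpace α] {μ : Measure α}
    [IsFiniteMeasure μ] [NeZero μ] {g : α → ℝ} (hg : Integrable g μ) (c : ℝ) :
    ⨍ x, |g x - ⨍ y, g y ∂μ| ∂μ ≤ 2 * ⨍ x, |g x - c| ∂μ := by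
  set ρ := (μ univ)⁻¹ • μ
  have hgρ : Integrable g ρ := hg.to_average
  change ∫ x, |g x - ∫ y, g y ∂ρ| ∂ρ ≤ 2 * ∫ x, |g x - c| ∂ρ
  have hc : Integrable (fun x => |g x - c|) ρ := (hgρ.sub (integrable_const c)).abs
  have hmean : |c - ∫ y, g y ∂ρ| ≤ ∫ x, |g x - c| ∂ρ := by
    have h : ∫ x, (g x - c) ∂ρ = ∫ x, g x ∂ρ - c := by
      rw [integral_sub hgρ (integrable_const c)]
      simp
    rw [abs_sub_comm, ← h]
    exact abs_integral_le_integral_abs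
  calc ∫ x, |g x - ∫ y, g y ∂ρ| ∂ρ
      ≤ ∫ x, (|g x - c| + |c - ∫ y, g y ∂ρ|) ∂ρ :=
        integral_mono (hgρ.sub (integrable_const _)).abs (hc.add (integrable_const _))
          fun x => abs_sub_le _ _ _
    _ = ∫ x, |g x - c| ∂ρ + |c - ∫ y, g y ∂ρ| := by
        rw [integral_add hc (integrable_const _)]
        simp
    _ ≤ 2 * ∫ x, |g x - c| ∂ρ := by linarith

theorem MeasureTheory.Integrable.max_min_const {α : Type*} [MeasurableSpace α] {μ : Measure α}
    [IsFiniteMeasure μ] {f : α → ℝ} (hf : Integrable f μ) (L U : ℝ) :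
    Integrable (fun x => max L (min U (f x))) μ :=
  (integrable_const L).sup ((integrable_const U).inf hf)

theorem average_abs_truncation_sub_average_le {α : Type*} [MeasurableSpace α] {μ : Measure α}
    [IsFiniteMeasure μ] [NeZero μ] {f : α → ℝ} (hf : Integrable f μ) (L U : ℝ) :
    ⨍ x, |max L (min U (f x)) - ⨍ y, max L (min U (f y)) ∂μ| ∂μ ≤
      2 * ⨍ x, |f x - ⨍ y, f y ∂μ| ∂μ := by
  refine (average_abs_sub_average_le (hf.max_min_const L U)
    (max L (min U (⨍ y, f y ∂μ)))).trans ?_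
  gcongr 2 * ?_
  exact integral_mono (((hf.max_min_const L U).to_average).sub (integrable_const _)).abs
    ((hf.to_average).sub (integrable_const _)).abs
    fun x => abs_max_min_sub_max_min_le L U _ _

theorem abs_truncation_le (k : ℕ) (a : ℝ) : |max (-(k : ℝ)) (min (k : ℝ) a)| ≤ |a| := by
  have h := abs_max_min_sub_max_min_le (-(k : ℝ)) k a 0
  simpa using h

theorem tendsto_truncation (a : ℝ) :
    Tendsto (fun k : ℕ => max (-(k : ℝ)) (min (k : ℝ) a)) atTop (nhds a) := by
  refine tendsto_const_nhds.congr' ?_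
  filter_upwards [eventually_ge_atTop ⌈|a|⌉₊] with k hk
  have h : |a| ≤ k := Nat.ceil_le.mp hk
  rw [min_eq_right (abs_le.mp h).2, max_eq_right (abs_le.mp h).1]

theorem tendsto_average_abs_truncation_sub_average {α : Type*} [MeasurableSpace α]
    {μ : Measure α} [IsFiniteMeasure μ] [NeZero μ] {f : α → ℝ} (hf : Integrable f μ) :
    Tendsto (fun k : ℕ => ⨍ x, |max (-(k : ℝ)) (min (k : ℝ) (f x)) -
        ⨍ y, max (-(k : ℝ)) (min (k : ℝ) (f y)) ∂μ| ∂μ) atTop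
      (nhds (⨍ x, |f x - ⨍ y, f y ∂μ| ∂μ)) := by
  set ρ := (μ univ)⁻¹ • μ
  have hfρ : Integrable f ρ := hf.to_average
  have hT (k : ℕ) : Integrable (fun x => max (-(k : ℝ)) (min (k : ℝ) (f x))) ρ :=
    hfρ.max_min_const _ _
  have hmean : Tendsto (fun k : ℕ => ∫ y, max (-(k : ℝ)) (min (k : ℝ) (f y)) ∂ρ) atTop
      (nhds (∫ y, f y ∂ρ)) :=
    tendsto_integral_of_dominated_convergence (fun x => |f x|)
      (fun k => (hT k).aestronglyMeasurable) hfρ.abs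
      (fun k => ae_of_all _ fun x => abs_truncation_le k (f x))
      (ae_of_all _ fun x => tendsto_truncation (f x))
  refine tendsto_integral_of_dominated_convergence
    (fun x => |f x| + ∫ y, |f y| ∂ρ)
    (fun k => ((hT k).sub (integrable_const _)).abs.aestronglyMeasurable)
    (hfρ.abs.add (integrable_const _)) (fun k => ae_of_all _ fun x => ?_)
    (ae_of_all _ fun x => ((tendsto_truncation (f x)).sub hmean).abs)
  rw [Real.norm_eq_abs, abs_abs]
  refine (abs_sub _ _).trans (add_le_add (abs_truncation_le k _) ?_)
  exact abs_integral_le_integral_abs.trans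
    (integral_mono (hT k).abs hfρ.abs fun y => abs_truncation_le k (f y))

/-- Lemma 3.2: for a Borel measure `ν`, a cube `Q` with `0 < ν(Q) < ∞` and
`f ∈ L¹_loc(dν)`, the mean oscillation of `f` over `Q` is squeezed between the
supremum over all truncations and twice the mean oscillation:
`(1/ν(Q)) ∫_Q |f − f_{Q,ν}| dν ≤ sup_{L<U} (1/ν(Q)) ∫_Q |τ_{LU}f − (τ_{LU}f)_{Q,ν}| dν
  ≤ (2/ν(Q)) ∫_Q |f − f_{Q,ν}| dν`. -/
theorem statement11 {n : ℕ} (ν : Measure (Fin n → ℝ)) (Q : Cube n)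
    (h0 : 0 < ν Q.carrier) (h1 : ν Q.carrier < ⊤)
    (f : (Fin n → ℝ) → ℝ) (hf : LocallyIntegrable f ν) :
    osc ν Q f ≤
        sSup {r : ℝ | ∃ L U : ℝ, L < U ∧ r = osc ν Q fun x => max L (min U (f x))} ∧
      sSup {r : ℝ | ∃ L U : ℝ, L < U ∧ r = osc ν Q fun x => max L (min U (f x))} ≤
        2 * osc ν Q f := by
  have hfQ : IntegrableOn f Q.carrier ν := by
    rw [Q.carrier_eq_Icc]
    exact hf.integrableOn_isCompact isCompact_Icc
  have : Fact (ν Q.carrier < ⊤) := ⟨h1⟩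
  have : NeZero (ν.restrict Q.carrier) := ⟨fun h => h0.ne' (Measure.restrict_eq_zero.mp h)⟩
  have hub : ∀ r ∈ {r : ℝ | ∃ L U : ℝ, L < U ∧ r = osc ν Q fun x => max L (min U (f x))},
      r ≤ 2 * osc ν Q f := by
    rintro r ⟨L, U, -, rfl⟩
    exact average_abs_truncation_sub_average_le hfQ L U
  refine ⟨?_, csSup_le ⟨_, 0, 1, one_pos, rfl⟩ hub⟩
  refine le_of_tendsto (tendsto_average_abs_truncation_sub_average hfQ) ?_
  filter_upwards [eventually_gt_atTop 0] with k hk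
  have hk' : (0 : ℝ) < k := Nat.cast_pos.mpr hk
  exact le_csSup ⟨_, hub⟩ ⟨-k, k, by linarith, rfl⟩

end
end

section
/- Let μ be a Borel measure on ℝⁿ, Q a cube with 0 < μ(Q) < ∞, f ∈ L¹(Q, dμ), and let B, c₁, c₂ > 0 be such that the John–Nirenberg-type inequality μ({x ∈ Q : |f(x) − f_{Q,μ}| > t}) ≤ c₁ e^{−t/(c₂ B)} μ(Q) holds for all t > 0. Let g : [0,∞) → [0,∞) be nonnegative, locally integrable, and set φ(x) := ∫₀^x g(t) dt. Then for every λ > 0: (1/μ(Q)) ∫_Q φ(|f − f_{Q,μ}|/λ) dμ ≤ c₁ ∫₀^∞ g(t) e^{−λ t/(c₂ B)} dt; consequently, if c₁ ∫₀^∞ g(t) e^{−λ t/(c₂ B)} dt ≤ 1 then ‖f − f_{Q,μ}‖_{φ(L)(Q, dμ/μ(Q))} ≤ λ. -/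
open MeasureTheory Set Filter
open scoped ENNReal

noncomputable section

/-- The Laplace-transform computation from the Introduction: if `f` satisfies a
John–Nirenberg inequality on `Q` with constants `c₁, c₂, B` and `φ(x) = ∫₀ˣ g`, with
`g ≥ 0` locally integrable, then for every `λ > 0`
`(1/μ(Q)) ∫_Q φ(|f − f_{Q,μ}|/λ) dμ ≤ c₁ ∫₀^∞ g(t) e^{−λ t/(c₂ B)} dt`; consequently,
if `c₁ ∫₀^∞ g(t) e^{−λ t/(c₂ B)} dt ≤ 1` then `‖f − f_{Q,μ}‖_{φ(L)(Q, dμ/μ(Q))} ≤ λ`. -/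
theorem statement14 {n : ℕ} (μ : Measure (Fin n → ℝ)) (Q : Cube n)
    (h0 : 0 < μ Q.carrier) (h1 : μ Q.carrier < ⊤)
    (f : (Fin n → ℝ) → ℝ) (hf : IntegrableOn f Q.carrier μ)
    (B c₁ c₂ : ℝ) (hB : 0 < B) (hc₁ : 0 < c₁) (hc₂ : 0 < c₂)
    (hJN : ∀ t : ℝ, 0 < t →
      μ {x ∈ Q.carrier | t < |f x - cubeAvg μ Q f|} ≤
        ENNReal.ofReal (c₁ * Real.exp (-t / (c₂ * B))) * μ Q.carrier)
    (g : ℝ → ℝ) (hg0 : ∀ t, 0 ≤ g t)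
    (hgint : ∀ x : ℝ, IntegrableOn g (Set.Icc 0 x))
    (φ : ℝ → ℝ) (hφ : ∀ x : ℝ, φ x = ∫ t in (0 : ℝ)..x, g t) :
    (∀ lam : ℝ, 0 < lam →
        ∫⁻ x in Q.carrier, ENNReal.ofReal (φ (|f x - cubeAvg μ Q f| / lam)) ∂μ ≤
          ENNReal.ofReal c₁ *
            (∫⁻ t in Set.Ioi (0 : ℝ),
              ENNReal.ofReal (g t * Real.exp (-(lam * t) / (c₂ * B)))) *
            μ Q.carrier) ∧
      ∀ lam : ℝ, 0 < lam →
        ENNReal.ofReal c₁ *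
            (∫⁻ t in Set.Ioi (0 : ℝ),
              ENNReal.ofReal (g t * Real.exp (-(lam * t) / (c₂ * B)))) ≤ 1 →
        luxNorm φ μ Q (fun x => f x - cubeAvg μ Q f) ≤ lam := by
  have key : ∀ lam : ℝ, 0 < lam →
      ∫⁻ x in Q.carrier, ENNReal.ofReal (φ (|f x - cubeAvg μ Q f| / lam)) ∂μ ≤
        ENNReal.ofReal c₁ *
          (∫⁻ t in Set.Ioi (0 : ℝ),
            ENNReal.ofReal (g t * Real.exp (-(lam * t) / (c₂ * B)))) *
          μ Q.carrier := by
    intro lam hlam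
    have hQ : MeasurableSet Q.carrier := by
      have hcl : Q.carrier = Set.Icc Q.corner (fun i => Q.corner i + Q.side) := by
        ext x
        simp only [Cube.carrier, Set.mem_ofPred_eq, Set.mem_Icc, Pi.le_def, forall_and]
      rw [hcl]
      exact measurableSet_Icc
    have : IsFiniteMeasure (μ.restrict Q.carrier) := ⟨by simpa using h1⟩
    have hmeas : AEMeasurable (fun x => |f x - cubeAvg μ Q f| / lam) (μ.restrict Q.carrier) :=
      ((continuous_abs.measurable.comp_aemeasurable
        (hf.aemeasurable.sub_const _)).div_const lam)
    have hcake := lintegral_comp_eq_lintegral_meas_lt_mul (μ.restrict Q.carrier)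
      (f := fun x => |f x - cubeAvg μ Q f| / lam) (g := g)
      (ae_of_all _ fun x => div_nonneg (abs_nonneg _) hlam.le) hmeas
      (fun t ht => (intervalIntegrable_iff_integrableOn_Icc_of_le ht.le).2 (hgint t))
      (ae_of_all _ hg0)
    simp only [hφ]
    rw [hcake, ← lintegral_const_mul' _ _ ENNReal.ofReal_ne_top,
      ← lintegral_mul_const' _ _ h1.ne]
    refine setLIntegral_mono' measurableSet_Ioi fun t ht => ?_
    have hset : {x | t < |f x - cubeAvg μ Q f| / lam} ∩ Q.carrier =
        {x ∈ Q.carrier | lam * t < |f x - cubeAvg μ Q f|} := by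
      ext x
      simp only [Set.mem_inter_iff, Set.mem_ofPred_eq, lt_div_iff₀ hlam, mul_comm t lam]
      exact and_comm
    rw [Measure.restrict_apply' hQ, hset]
    calc _ ≤ ENNReal.ofReal (c₁ * Real.exp (-(lam * t) / (c₂ * B))) * μ Q.carrier *
          ENNReal.ofReal (g t) := by
          gcongr
          exact hJN _ (mul_pos hlam ht)
      _ = _ := by
          rw [ENNReal.ofReal_mul hc₁.le, ENNReal.ofReal_mul (hg0 t)]
          ring
  refine ⟨key, fun lam hlam hle => csInf_le ⟨0, fun l hl => hl.1.le⟩ ⟨hlam, ?_⟩⟩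
  exact (key lam hlam).trans (mul_le_of_le_one_left' hle)

end
end

section
/- Let μ be a doubling measure on ℝⁿ, let w ∈ L¹_loc(ℝⁿ, dμ) be a weight (w ≥ 0), let p ≥ 1, and let Y : 𝒬 → (0,∞) be a functional on cubes satisfying: (i) w(Q) := ∫_Q w dμ ≤ Y(Q) for every cube Q; and (ii) there exist a constant C_Y > 0 and an increasing bijection Ψ : [0,1] → [0,1] such that for every cube Q, every countable pairwise-disjoint family {Q_j}_{j∈ℕ} of subcubes of Q, and all nonnegative measurable functions h_j with (1/Y(Q_j)) ∫_{Q_j} h_j^p w dμ = 1, one has ((1/Y(Q)) ∫_Q (Σ_j h_j χ_{Q_j})^p w dμ)^{1/p} ≤ C_Y Ψ⁻¹(μ(⋃_j Q_j)/μ(Q)). Then for every f ∈ BMO(dμ), every cube Q, and every L > max{1, 1/Ψ(1/C_Y)}: ((1/Y(Q)) ∫_Q |f − f_{Q,μ}|^p w dμ)^{1/p} ≤ (c_μ 2^{n_μ} + 1) · (L / (1 − C_Y Ψ⁻¹(1/L))) · ‖f‖_{BMO(dμ)}. -/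
open MeasureTheory Set Filter
open scoped ENNReal

noncomputable section

/-- The local average `((1/Y(Q)) ∫_Q |f|^p w dμ)^{1/p}` (valued in `ℝ≥0∞`). -/
def YLpNorm {n : ℕ} (μ : Measure (Fin n → ℝ)) (w : (Fin n → ℝ) → ℝ) (Y : Cube n → ℝ)
    (p : ℝ) (Q : Cube n) (f : (Fin n → ℝ) → ℝ) : ℝ≥0∞ :=
  ((∫⁻ x in Q.carrier, ENNReal.ofReal (|f x| ^ p * w x) ∂μ) / ENNReal.ofReal (Y Q)) ^ (1 / p)

namespace Cube

variable {n : ℕ}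

/-- The half-open version of a cube. -/
def half (Q : Cube n) : Set (Fin n → ℝ) :=
  {x | ∀ i, Q.corner i ≤ x i ∧ x i < Q.corner i + Q.side}

/-- The center of a cube. -/
def center (Q : Cube n) : Fin n → ℝ := fun i => Q.corner i + Q.side / 2

theorem carrier_eq_closedBall (Q : Cube n) :
    Q.carrier = Metric.closedBall Q.center (Q.side / 2) := by
  ext x
  have := Q.side_pos
  rw [Metric.mem_closedBall, dist_pi_le_iff (by positivity)]
  refine forall_congr' fun i => ?_
  rw [Real.dist_eq, abs_le, center]
  constructor <;> rintro ⟨h1, h2⟩ <;> constructor <;> linarith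

theorem measurableSet_carrier (Q : Cube n) : MeasurableSet Q.carrier := by
  rw [carrier_eq_closedBall]
  exact Metric.isClosed_closedBall.measurableSet

theorem isCompact_carrier (Q : Cube n) : IsCompact Q.carrier := by
  rw [carrier_eq_closedBall]
  exact isCompact_closedBall _ _

theorem measurableSet_half (Q : Cube n) : MeasurableSet Q.half := by
  have : Q.half = Set.univ.pi fun i => Set.Ico (Q.corner i) (Q.corner i + Q.side) := by
    ext x; simp [half, Set.mem_pi]
  rw [this]
  exact MeasurableSet.univ_pi fun i => measurableSet_Ico

theorem half_subset_carrier (Q : Cube n) : Q.half ⊆ Q.carrier :=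
  fun _ hx i => ⟨(hx i).1, (hx i).2.le⟩

/-- The cube with a given center and radius. -/
def ofBall (x : Fin n → ℝ) (r : ℝ) (hr : 0 < r) : Cube n :=
  ⟨fun i => x i - r, 2 * r, by positivity⟩

theorem carrier_ofBall (x : Fin n → ℝ) (r : ℝ) (hr : 0 < r) :
    (ofBall x r hr).carrier = Metric.closedBall x r := by
  rw [carrier_eq_closedBall]
  congr 1
  · ext i; simp [center, ofBall]
  · simp [ofBall]

/-- The dyadic children of a cube, indexed by the choice of a half in every coordinate. -/
def child (Q : Cube n) (b : Fin n → Bool) : Cube n :=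
  ⟨fun i => Q.corner i + if b i then Q.side / 2 else 0, Q.side / 2, half_pos Q.side_pos⟩

theorem child_half_subset (Q : Cube n) (b : Fin n → Bool) : (Q.child b).half ⊆ Q.half := by
  intro x hx i
  have h := hx i
  have := Q.side_pos
  simp only [child] at h
  split_ifs at h <;> constructor <;> linarith [h.1, h.2]

theorem child_carrier_subset (Q : Cube n) (b : Fin n → Bool) :
    (Q.child b).carrier ⊆ Q.carrier := by
  intro x hx i
  have h := hx i
  have := Q.side_pos
  simp only [child] at h
  split_ifs at h <;> constructor <;> linarith [h.1, h.2]

theorem exists_mem_child_half (Q : Cube n) {x : Fin n → ℝ} (hx : x ∈ Q.half) :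
    ∃ b, x ∈ (Q.child b).half := by
  refine ⟨fun i => decide (Q.corner i + Q.side / 2 ≤ x i), fun i => ?_⟩
  have h := hx i
  by_cases hi : Q.corner i + Q.side / 2 ≤ x i
  · refine ⟨?_, ?_⟩ <;> simp [child, hi]
    linarith [h.1, h.2]
  · push Not at hi
    refine ⟨?_, ?_⟩ <;> simp [child, hi.not_ge, hi, h.1]

theorem disjoint_child_half (Q : Cube n) {b b' : Fin n → Bool} (h : b ≠ b') :
    Disjoint (Q.child b).half (Q.child b').half := by
  rw [Set.disjoint_left]
  intro x hx hx'
  apply h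
  ext i
  have h1 := hx i
  have h2 := hx' i
  simp only [child] at h1 h2
  cases hb : b i <;> cases hb' : b' i <;> simp [hb, hb'] at h1 h2 ⊢ <;> linarith [h1.1, h1.2, h2.1, h2.2]

/-- The cubes with the same lower corner that increase to the half-open cube. -/
def shrink (Q : Cube n) (k : ℕ) : Cube n :=
  ⟨Q.corner, Q.side * (1 - 1 / ((k : ℝ) + 2)), by
    have := Q.side_pos
    have : 1 / ((k : ℝ) + 2) < 1 := by rw [div_lt_one (by positivity)]; linarith [k.cast_nonneg (α := ℝ)]
    apply mul_pos ‹_›; linarith⟩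

theorem shrink_carrier_subset (Q : Cube n) (k : ℕ) : (Q.shrink k).carrier ⊆ Q.half := by
  intro x hx i
  refine ⟨(hx i).1, (hx i).2.trans_lt ?_⟩
  simp only [shrink]
  have : 0 < Q.side * (1 / ((k : ℝ) + 2)) := mul_pos Q.side_pos (by positivity)
  linarith

theorem monotone_shrink_carrier (Q : Cube n) : Monotone fun k => (Q.shrink k).carrier := by
  intro k l hkl x hx i
  refine ⟨(hx i).1, (hx i).2.trans ?_⟩
  have := Q.side_pos.le
  simp only [shrink]
  gcongr

theorem iUnion_shrink_carrier (Q : Cube n) : ⋃ k, (Q.shrink k).carrier = Q.half := by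
  apply subset_antisymm (iUnion_subset Q.shrink_carrier_subset)
  intro x hx
  have hlim : ∀ i, Tendsto (fun k : ℕ => Q.corner i + Q.side * (1 - 1 / ((k : ℝ) + 2))) atTop
      (nhds (Q.corner i + Q.side * (1 - 0))) := by
    intro i
    refine ((tendsto_const_nhds.sub ?_).const_mul _).const_add _
    refine tendsto_const_nhds.div_atTop ?_
    exact tendsto_atTop_add_const_right _ _ tendsto_natCast_atTop_atTop
  have : ∀ᶠ k : ℕ in atTop, ∀ i, x i < Q.corner i + Q.side * (1 - 1 / ((k : ℝ) + 2)) := by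
    rw [eventually_all]
    intro i
    exact (hlim i).eventually_const_lt (by simpa using (hx i).2)
  obtain ⟨k, hk⟩ := this.exists
  exact mem_iUnion.2 ⟨k, fun i => ⟨(hx i).1, (hk i).le⟩⟩

end Cube

namespace IsDoubling

variable {n : ℕ} {μ : Measure (Fin n → ℝ)} {c d : ℝ}

theorem isLocallyFiniteMeasure (hμ : IsDoubling μ c d) : IsLocallyFiniteMeasure μ :=
  ⟨fun x => ⟨Metric.closedBall x 1, Metric.closedBall_mem_nhds x one_pos, by
    rw [← Cube.carrier_ofBall x 1 one_pos]; exact (hμ.2.2.1 _).2⟩⟩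

theorem isUnifLocDoublingMeasure (hμ : IsDoubling μ c d) : IsUnifLocDoublingMeasure μ := by
  refine ⟨(c * 2 ^ d).toNNReal, ?_⟩
  filter_upwards [self_mem_nhdsWithin] with ε hε x
  have hε : 0 < ε := hε
  rw [← Cube.carrier_ofBall x ε hε, ← Cube.carrier_ofBall x (2 * ε) (by positivity)]
  convert hμ.2.2.2 _ _ ?_ using 3
  · simp only [Cube.ofBall]
    congr 3
    field_simp
  · rw [Cube.carrier_ofBall, Cube.carrier_ofBall]
    exact Metric.closedBall_subset_closedBall (by linarith)

theorem measureReal_pos (hμ : IsDoubling μ c d) (Q : Cube n) : 0 < μ.real Q.carrier :=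
  ENNReal.toReal_pos (hμ.2.2.1 Q).1.ne' (hμ.2.2.1 Q).2.ne

theorem measureReal_le_child (hμ : IsDoubling μ c d) (Q : Cube n) (b : Fin n → Bool) :
    μ.real Q.carrier ≤ c * 2 ^ d * μ.real (Q.child b).carrier := by
  have h := hμ.2.2.2 _ _ (Q.child_carrier_subset b)
  have h2 : Q.side / (Q.child b).side = 2 := by
    have := Q.side_pos
    simp only [Cube.child]; field_simp
  rw [h2] at h
  have h3 := ENNReal.toReal_mono (ENNReal.mul_ne_top ENNReal.ofReal_ne_top
    (hμ.2.2.1 (Q.child b)).2.ne) h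
  rwa [ENNReal.toReal_mul, ENNReal.toReal_ofReal] at h3
  have := hμ.1
  positivity

theorem measure_hyperplane (hμ : IsDoubling μ c d) (i : Fin n) (t : ℝ) :
    μ {x | x i = t} = 0 := by
  have := hμ.isLocallyFiniteMeasure
  have := hμ.isUnifLocDoublingMeasure
  set H : Set (Fin n → ℝ) := {x | x i = t}
  have h := IsUnifLocDoublingMeasure.ae_tendsto_measure_inter_div μ H 2
  have hH : MeasurableSet H := measurableSet_eq_fun (measurable_pi_apply i) measurable_const
  rw [ae_restrict_iff' hH] at h
  rw [← compl_compl H, ← mem_ae_iff]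
  filter_upwards [h] with x hx hxH
  have hδ : Tendsto (fun k : ℕ => 1 / ((k : ℝ) + 1)) atTop (nhdsWithin 0 (Set.Ioi 0)) :=
    tendsto_nhdsWithin_iff.2 ⟨tendsto_one_div_add_atTop_nhds_zero_nat,
      Eventually.of_forall fun k => by simp only [Set.mem_Ioi]; positivity⟩
  have hl := hx hxH (fun k : ℕ => x + Pi.single i (2 * (1 / ((k : ℝ) + 1)))) _ hδ
    (Eventually.of_forall fun k => by
      rw [Metric.mem_closedBall, dist_comm, dist_self_add_left, Pi.norm_single,
        Real.norm_of_nonneg (by positivity)])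
  have hz : ∀ k : ℕ, H ∩ Metric.closedBall (x + Pi.single i (2 * (1 / ((k : ℝ) + 1))))
      (1 / ((k : ℝ) + 1)) = ∅ := by
    intro k
    rw [← Set.disjoint_iff_inter_eq_empty, Set.disjoint_left]
    intro y hy hyb
    have h1 := (dist_le_pi_dist _ _ i).trans (Metric.mem_closedBall.1 hyb)
    have hpos : 0 < 1 / ((k : ℝ) + 1) := by positivity
    have hxt : x i = t := hxH
    have hyt : y i = t := hy
    rw [Pi.add_apply, Pi.single_eq_same, hyt, hxt, Real.dist_eq, abs_le] at h1
    linarith [h1.1, h1.2]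
  simp only [hz, measure_empty, ENNReal.zero_div] at hl
  exact zero_ne_one (tendsto_nhds_unique tendsto_const_nhds hl)

theorem half_ae_eq_carrier (hμ : IsDoubling μ c d) (Q : Cube n) :
    Q.half =ᵐ[μ] Q.carrier := by
  refine Q.half_subset_carrier.eventuallyLE.antisymm ?_
  have h : ∀ᵐ x ∂μ, ∀ i, x i ≠ Q.corner i + Q.side := by
    rw [ae_all_iff]
    intro i
    rw [ae_iff]
    simpa using hμ.measure_hyperplane i (Q.corner i + Q.side)
  filter_upwards [h] with x hx hxQ i
  exact ⟨(hxQ i).1, lt_of_le_of_ne (hxQ i).2 (hx i)⟩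

/-- The Calderón-Zygmund decomposition of a cube at height `t`, stopped after `K` generations. -/
theorem exists_calderonZygmund (hμ : IsDoubling μ c d) {g : (Fin n → ℝ) → ℝ}
    (hg0 : ∀ x, 0 ≤ g x) (hg : LocallyIntegrable g μ) {t : ℝ} (ht : 0 ≤ t) (K : ℕ) :
    ∀ R : Cube n, ∫ x in R.carrier, g x ∂μ ≤ t * μ.real R.carrier →
    ∃ S : Finset (Cube n),
      (∀ P ∈ S, P.half ⊆ R.half ∧ t * μ.real P.carrier < ∫ x in P.carrier, g x ∂μ ∧
        ∫ x in P.carrier, g x ∂μ ≤ c * 2 ^ d * t * μ.real P.carrier) ∧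
      (S : Set (Cube n)).PairwiseDisjoint Cube.half ∧
      ∀ x ∈ R.half, (∀ P ∈ S, x ∉ P.half) → ∃ C : Cube n, C.side = R.side / 2 ^ K ∧
        x ∈ C.carrier ∧ ∫ x in C.carrier, g x ∂μ ≤ t * μ.real C.carrier := by
  classical
  induction K with
  | zero =>
    intro R hR
    exact ⟨∅, by simp, by simp, fun x hx _ => ⟨R, by simp, R.half_subset_carrier hx, hR⟩⟩
  | succ K ih =>
    intro R hR
    have key : ∀ b : Fin n → Bool, ∃ S : Finset (Cube n),
        (∀ P ∈ S, P.half ⊆ (R.child b).half ∧ t * μ.real P.carrier < ∫ x in P.carrier, g x ∂μ ∧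
          ∫ x in P.carrier, g x ∂μ ≤ c * 2 ^ d * t * μ.real P.carrier) ∧
        (S : Set (Cube n)).PairwiseDisjoint Cube.half ∧
        ∀ x ∈ (R.child b).half, (∀ P ∈ S, x ∉ P.half) →
          ∃ C : Cube n, C.side = R.side / 2 ^ (K + 1) ∧
          x ∈ C.carrier ∧ ∫ x in C.carrier, g x ∂μ ≤ t * μ.real C.carrier := by
      intro b
      by_cases hb : ∫ x in (R.child b).carrier, g x ∂μ ≤ t * μ.real (R.child b).carrier
      · obtain ⟨S, h1, h2, h3⟩ := ih (R.child b) hb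
        refine ⟨S, h1, h2, fun x hx hxS => ?_⟩
        obtain ⟨C, hC, hC'⟩ := h3 x hx hxS
        exact ⟨C, by rw [hC, pow_succ']; simp only [Cube.child]; field_simp, hC'⟩
      · refine ⟨{R.child b}, ?_, by simp, fun x hx hxS => absurd hx (hxS _ (by simp))⟩
        simp only [Finset.mem_singleton, forall_eq]
        refine ⟨subset_rfl, not_le.1 hb, ?_⟩
        calc ∫ x in (R.child b).carrier, g x ∂μ ≤ ∫ x in R.carrier, g x ∂μ :=
              setIntegral_mono_set (hg.integrableOn_isCompact R.isCompact_carrier)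
                (Eventually.of_forall hg0) (R.child_carrier_subset b).eventuallyLE
          _ ≤ t * μ.real R.carrier := hR
          _ ≤ t * (c * 2 ^ d * μ.real (R.child b).carrier) := by
              gcongr; exact hμ.measureReal_le_child R b
          _ = _ := by ring
    choose S h1 h2 h3 using key
    refine ⟨Finset.univ.biUnion S, ?_, ?_, ?_⟩
    · intro P hP
      obtain ⟨b, -, hb⟩ := Finset.mem_biUnion.1 hP
      exact ⟨(h1 b P hb).1.trans (R.child_half_subset b), (h1 b P hb).2⟩
    · intro P hP P' hP' hne
      obtain ⟨b, -, hb⟩ := Finset.mem_biUnion.1 hP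
      obtain ⟨b', -, hb'⟩ := Finset.mem_biUnion.1 hP'
      by_cases hbb : b = b'
      · subst hbb
        exact h2 b hb hb' hne
      · exact (R.disjoint_child_half hbb).mono (h1 b P hb).1 (h1 b' P' hb').1
    · intro x hx hxS
      obtain ⟨b, hb⟩ := R.exists_mem_child_half hx
      exact h3 b x hb fun P hP => hxS P (Finset.mem_biUnion.2 ⟨b, Finset.mem_univ _, hP⟩)

/-- Lebesgue differentiation along shrinking cubes containing a point. -/
theorem ae_le_of_small_cubes (hμ : IsDoubling μ c d) {g : (Fin n → ℝ) → ℝ}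
    (hg : LocallyIntegrable g μ) (t s : ℝ) (hs : 0 < s) :
    ∀ᵐ x ∂μ, t < g x → ∀ᶠ K : ℕ in atTop, ∀ C : Cube n, C.side = s / 2 ^ K → x ∈ C.carrier →
      t * μ.real C.carrier < ∫ x in C.carrier, g x ∂μ := by
  classical
  have := hμ.isLocallyFiniteMeasure
  have := hμ.isUnifLocDoublingMeasure
  filter_upwards [IsUnifLocDoublingMeasure.ae_tendsto_average μ hg 1] with x hx hxt
  have hex : ∀ K : ℕ, ∃ C : Cube n, C.side = s / 2 ^ K ∧ x ∈ C.carrier ∧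
      ((∃ C' : Cube n, C'.side = s / 2 ^ K ∧ x ∈ C'.carrier ∧
        ∫ x in C'.carrier, g x ∂μ ≤ t * μ.real C'.carrier) →
        ∫ x in C.carrier, g x ∂μ ≤ t * μ.real C.carrier) := by
    intro K
    by_cases h : ∃ C' : Cube n, C'.side = s / 2 ^ K ∧ x ∈ C'.carrier ∧
        ∫ x in C'.carrier, g x ∂μ ≤ t * μ.real C'.carrier
    · obtain ⟨C, h1, h2, h3⟩ := h
      exact ⟨C, h1, h2, fun _ => h3⟩
    · have hpos : 0 < s / 2 ^ K := by positivity
      refine ⟨⟨x, s / 2 ^ K, hpos⟩, rfl, fun i => ⟨le_rfl, ?_⟩, fun h' => absurd h' h⟩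
      simpa using hpos.le
  choose C hCs hxC hC using hex
  have hδ : Tendsto (fun K : ℕ => (C K).side / 2) atTop (nhdsWithin 0 (Set.Ioi 0)) := by
    refine tendsto_nhdsWithin_iff.2 ⟨?_, Eventually.of_forall fun k => half_pos (C k).side_pos⟩
    have h2 : Tendsto (fun K : ℕ => s / 2 * (1 / 2 : ℝ) ^ K) atTop (nhds (s / 2 * 0)) :=
      (tendsto_pow_atTop_nhds_zero_of_lt_one (by norm_num) (by norm_num)).const_mul _
    rw [mul_zero] at h2
    refine h2.congr fun K => ?_
    rw [hCs, one_div, inv_pow]; ring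
  have hl := hx (fun K => (C K).center) _ hδ (Eventually.of_forall fun K => by
    rw [one_mul, ← Cube.carrier_eq_closedBall]; exact hxC K)
  simp only [← Cube.carrier_eq_closedBall] at hl
  filter_upwards [hl.eventually_const_lt hxt] with K hK C' hC's hxC'
  by_contra! hcon
  have h := hC K ⟨C', hC's, hxC', hcon⟩
  rw [setAverage_eq, smul_eq_mul, ← div_eq_inv_mul, lt_div_iff₀ (hμ.measureReal_pos _)] at hK
  linarith

theorem locallyIntegrable_abs_sub (hμ : IsDoubling μ c d) {f : (Fin n → ℝ) → ℝ}
    (hf : LocallyIntegrable f μ) (a : ℝ) : LocallyIntegrable (fun x => |f x - a|) μ := by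
  have := hμ.isLocallyFiniteMeasure
  intro x
  obtain ⟨s, hs, h⟩ := hf.sub (locallyIntegrable_const a) x
  exact ⟨s, hs, h.norm⟩

theorem abs_cubeAvg_sub_mul_le (hμ : IsDoubling μ c d) {f : (Fin n → ℝ) → ℝ}
    (hf : LocallyIntegrable f μ) (a : ℝ) (Q : Cube n) :
    |cubeAvg μ Q f - a| * μ.real Q.carrier ≤ ∫ x in Q.carrier, |f x - a| ∂μ := by
  have := hμ.isLocallyFiniteMeasure
  have hpos := hμ.measureReal_pos Q
  have h1 : (cubeAvg μ Q f - a) * μ.real Q.carrier = ∫ x in Q.carrier, (f x - a) ∂μ := by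
    rw [integral_sub (hf.integrableOn_isCompact Q.isCompact_carrier)
      ((locallyIntegrable_const a).integrableOn_isCompact Q.isCompact_carrier),
      setIntegral_const, smul_eq_mul, cubeAvg, setAverage_eq, smul_eq_mul]
    field_simp
  nth_rw 1 [← abs_of_pos hpos]
  rw [← abs_mul, h1]
  exact abs_integral_le_integral_abs

theorem integral_eq_osc_mul (hμ : IsDoubling μ c d) (f : (Fin n → ℝ) → ℝ) (Q : Cube n) :
    ∫ x in Q.carrier, |f x - cubeAvg μ Q f| ∂μ = osc μ Q f * μ.real Q.carrier := by
  have hpos := hμ.measureReal_pos Q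
  rw [osc, setAverage_eq, smul_eq_mul]
  field_simp

theorem tendsto_shrink_integral (hμ : IsDoubling μ c d) {g : (Fin n → ℝ) → ℝ}
    (hg : LocallyIntegrable g μ) (P : Cube n) :
    Tendsto (fun k => ∫ x in (P.shrink k).carrier, g x ∂μ) atTop
      (nhds (∫ x in P.carrier, g x ∂μ)) := by
  rw [← setIntegral_congr_set (hμ.half_ae_eq_carrier P), ← P.iUnion_shrink_carrier]
  refine tendsto_setIntegral_of_monotone (fun k => (P.shrink k).measurableSet_carrier)
    P.monotone_shrink_carrier ?_
  rw [P.iUnion_shrink_carrier]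
  exact (hg.integrableOn_isCompact P.isCompact_carrier).mono_set P.half_subset_carrier

theorem tendsto_shrink_measureReal (hμ : IsDoubling μ c d) (P : Cube n) :
    Tendsto (fun k => μ.real (P.shrink k).carrier) atTop (nhds (μ.real P.carrier)) := by
  have := hμ.isLocallyFiniteMeasure
  simpa using hμ.tendsto_shrink_integral (locallyIntegrable_const (1 : ℝ)) P

/-- A finite sparse family of disjoint closed subcubes of `Q` outside of which, up to a set of
small measure, `f` is close to its average. -/
theorem exists_sparse_cubes (hμ : IsDoubling μ c d) {f : (Fin n → ℝ) → ℝ}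
    (hfm : Measurable f) (hf : LocallyIntegrable f μ) {L B : ℝ} (hL : 1 < L) (hB : 0 < B)
    (Q : Cube n) (hosc : osc μ Q f ≤ B) (ν : Measure (Fin n → ℝ)) [IsFiniteMeasure ν]
    (hν : ν ≪ μ) {ε : ℝ≥0∞} (hε : 0 < ε) :
    ∃ (T : Finset (Cube n)) (bad : Set (Fin n → ℝ)),
      (∀ R ∈ T, R.carrier ⊆ Q.carrier) ∧ (T : Set (Cube n)).PairwiseDisjoint Cube.carrier ∧
      μ.real (⋃ R ∈ T, R.carrier) ≤ μ.real Q.carrier / L ∧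
      (∀ R ∈ T, |cubeAvg μ R f - cubeAvg μ Q f| ≤ (c * 2 ^ d + 1) * (L * B)) ∧
      ν bad ≤ ε ∧
      ∀ x ∈ Q.carrier, |f x - cubeAvg μ Q f| ≤ L * B ∨ x ∈ bad ∨ ∃ R ∈ T, x ∈ R.carrier := by
  classical
  set g : (Fin n → ℝ) → ℝ := fun x => |f x - cubeAvg μ Q f| with hgdef
  have hg0 : ∀ x, 0 ≤ g x := fun x => abs_nonneg _
  have hg : LocallyIntegrable g μ := hμ.locallyIntegrable_abs_sub hf _
  have hgm : Measurable g := (hfm.sub_const _).abs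
  have ht : 0 < L * B := by positivity
  have hgQ : ∫ x in Q.carrier, g x ∂μ ≤ B * μ.real Q.carrier := by
    rw [hgdef, hμ.integral_eq_osc_mul]; gcongr
  have hBL : B ≤ L * B := le_mul_of_one_le_left hB.le hL.le
  choose S h1 h2 h3 using fun K => hμ.exists_calderonZygmund hg0 hg ht.le K Q
    (hgQ.trans (by gcongr))
  -- points missed by the stopped decomposition
  let E : ℕ → Set (Fin n → ℝ) := fun K =>
    (Q.half \ ⋃ P ∈ S K, P.half) ∩ {x | L * B < g x}
  have hE : Tendsto (fun K => ν (E K)) atTop (nhds (ν ∅)) := by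
    refine tendsto_measure_of_ae_tendsto_indicator_of_isFiniteMeasure _ MeasurableSet.empty
      (fun K => ?_) ?_
    · exact (Q.measurableSet_half.diff
        (Finset.measurableSet_biUnion _ fun P _ => P.measurableSet_half)).inter
        (measurableSet_lt measurable_const hgm)
    · filter_upwards [hν.ae_le (hμ.ae_le_of_small_cubes hg (L * B) Q.side Q.side_pos)] with x hx
      by_cases hxt : L * B < g x
      · filter_upwards [hx hxt] with K hK
        simp only [mem_empty_iff_false, iff_false]
        rintro ⟨⟨hxQ, hxS⟩, -⟩
        obtain ⟨C, hC1, hC2, hC3⟩ := h3 K x hxQ fun P hP hxP =>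
          hxS (mem_biUnion (show P ∈ (S K : Set (Cube n)) from hP) hxP)
        exact (hK C hC1 hC2).not_ge hC3
      · exact Eventually.of_forall fun K => by simp [E, hxt]
  rw [measure_empty] at hE
  obtain ⟨K, hK⟩ := (hE.eventually_lt_const (ENNReal.half_pos hε.ne')).exists
  have hF : ∀ P : Cube n, Tendsto (fun k => ν (P.half \ (P.shrink k).carrier)) atTop (nhds 0) := by
    intro P
    rw [← measure_empty (μ := ν)]
    have hi : ⋂ k, (P.half \ (P.shrink k).carrier) = ∅ := by
      rw [← sdiff_iUnion, P.iUnion_shrink_carrier, sdiff_self]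
    rw [← hi]
    refine tendsto_measure_iInter_atTop
      (fun k => (P.measurableSet_half.diff (P.shrink k).measurableSet_carrier).nullMeasurableSet)
      (fun k l hkl => sdiff_subset_sdiff_right (P.monotone_shrink_carrier hkl)) ⟨0, by finiteness⟩
  have hF' : Tendsto (fun k => ∑ P ∈ S K, ν (P.half \ (P.shrink k).carrier)) atTop (nhds 0) := by
    simpa using tendsto_finsetSum (S K) fun P _ => hF P
  have hG : ∀ᶠ k in atTop, ∀ P ∈ S K, ∫ x in (P.shrink k).carrier, g x ∂μ <
      (c * 2 ^ d + 1) * (L * B) * μ.real (P.shrink k).carrier := by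
    rw [eventually_all_finset]
    intro P hP
    refine (hμ.tendsto_shrink_integral hg P).eventually_lt
      ((hμ.tendsto_shrink_measureReal P).const_mul _) ((h1 K P hP).2.2.trans_lt ?_)
    have := mul_pos ht (hμ.measureReal_pos P)
    nlinarith
  obtain ⟨k, hk1, hk2⟩ :=
    ((hF'.eventually_lt_const (ENNReal.half_pos hε.ne')).and hG).exists
  refine ⟨(S K).image fun P => P.shrink k,
    (Q.carrier \ Q.half) ∪ (E K ∪ ⋃ P ∈ S K, (P.half \ (P.shrink k).carrier)), ?_, ?_, ?_, ?_, ?_,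
    ?_⟩
  · simp only [Finset.mem_image, forall_exists_index, and_imp, forall_apply_eq_imp_iff₂]
    intro P hP
    exact (P.shrink_carrier_subset k).trans ((h1 K P hP).1.trans Q.half_subset_carrier)
  · intro R hR R' hR' hne
    obtain ⟨P, hP, rfl⟩ := Finset.mem_image.1 hR
    obtain ⟨P', hP', rfl⟩ := Finset.mem_image.1 hR'
    exact (h2 K hP hP' fun h => hne (by rw [h])).mono (P.shrink_carrier_subset k)
      (P'.shrink_carrier_subset k)
  · have hsub : (⋃ R ∈ (S K).image fun P => P.shrink k, R.carrier) ⊆ ⋃ P ∈ S K, P.half := by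
      simp only [Finset.mem_image, iUnion_exists, biUnion_and', iUnion_iUnion_eq_right]
      exact iUnion₂_mono fun P _ => P.shrink_carrier_subset k
    have hUQ : (⋃ P ∈ S K, P.half) ⊆ Q.carrier :=
      iUnion₂_subset fun P hP => (h1 K P hP).1.trans Q.half_subset_carrier
    have hfin : ∀ P : Cube n, μ P.half ≠ ⊤ := fun P =>
      ((measure_mono P.half_subset_carrier).trans_lt (hμ.2.2.1 P).2).ne
    have hUfin : μ (⋃ P ∈ S K, P.half) ≠ ⊤ := ((measure_mono hUQ).trans_lt (hμ.2.2.1 Q).2).ne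
    refine (measureReal_mono hsub hUfin).trans ?_
    rw [le_div_iff₀ (by positivity)]
    refine le_of_mul_le_mul_right ?_ hB
    calc μ.real (⋃ P ∈ S K, P.half) * L * B
        = ∑ P ∈ S K, (L * B) * μ.real P.carrier := by
          rw [measureReal_biUnion_finset (h2 K) (fun P _ => P.measurableSet_half)
            (fun P _ => hfin P), ← Finset.mul_sum, mul_assoc, mul_comm]
          congr 1
          exact Finset.sum_congr rfl fun P _ => measureReal_congr (hμ.half_ae_eq_carrier P)
      _ ≤ ∑ P ∈ S K, ∫ x in P.half, g x ∂μ := by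
          refine Finset.sum_le_sum fun P hP => ?_
          rw [setIntegral_congr_set (hμ.half_ae_eq_carrier P)]
          exact (h1 K P hP).2.1.le
      _ = ∫ x in ⋃ P ∈ S K, P.half, g x ∂μ := by
          rw [integral_biUnion_finset _ (fun P _ => P.measurableSet_half) (h2 K)]
          exact fun P _ =>
            (hg.integrableOn_isCompact P.isCompact_carrier).mono_set P.half_subset_carrier
      _ ≤ ∫ x in Q.carrier, g x ∂μ :=
          setIntegral_mono_set (hg.integrableOn_isCompact Q.isCompact_carrier)
            (Eventually.of_forall hg0) hUQ.eventuallyLE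
      _ ≤ B * μ.real Q.carrier := hgQ
      _ = _ := mul_comm _ _
  · simp only [Finset.mem_image, forall_exists_index, and_imp, forall_apply_eq_imp_iff₂]
    intro P hP
    exact le_of_mul_le_mul_right ((hμ.abs_cubeAvg_sub_mul_le hf _ _).trans (hk2 P hP).le)
      (hμ.measureReal_pos _)
  · have hnull : ν (Q.carrier \ Q.half) = 0 :=
      hν (ae_le_set.1 (hμ.half_ae_eq_carrier Q).symm.le)
    calc ν _ ≤ ν (Q.carrier \ Q.half) +
          (ν (E K) + ∑ P ∈ S K, ν (P.half \ (P.shrink k).carrier)) :=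
          (measure_union_le _ _).trans (add_le_add le_rfl ((measure_union_le _ _).trans
            (add_le_add le_rfl (measure_biUnion_finset_le _ _))))
      _ ≤ 0 + (ε / 2 + ε / 2) := add_le_add hnull.le (add_le_add hK.le hk1.le)
      _ = ε := by rw [zero_add, ENNReal.add_halves]
  · intro x hx
    by_cases hxt : g x ≤ L * B
    · exact Or.inl hxt
    refine Or.inr ?_
    by_cases hxh : x ∈ Q.half
    swap
    · exact Or.inl (Or.inl ⟨hx, hxh⟩)
    by_cases hxS : x ∈ ⋃ P ∈ S K, P.half
    swap
    · exact Or.inl (Or.inr (Or.inl ⟨⟨hxh, hxS⟩, not_le.1 hxt⟩))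
    obtain ⟨P, hP, hxP⟩ := mem_iUnion₂.1 hxS
    by_cases hxk : x ∈ (P.shrink k).carrier
    · exact Or.inr ⟨_, Finset.mem_image_of_mem _ hP, hxk⟩
    · exact Or.inl (Or.inr (Or.inr (mem_iUnion₂.2 ⟨P, hP, hxP, hxk⟩)))

end IsDoubling

theorem eLpNorm_le_of_ae_le_const_add {α : Type*} [MeasurableSpace α] {ν : Measure α}
    (hν : ν univ ≤ 1) {q : ℝ≥0∞} (hq : 1 ≤ q) {u s : α → ℝ} (hs : Measurable s) {a b r : ℝ}
    (ha : 0 ≤ a) (hb : 0 ≤ b) (hr : 0 ≤ r) {E : Set α}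
    (hE : MeasurableSet E)
    (h : ∀ᵐ x ∂ν, ‖u x‖ ≤ a + b * s x + E.indicator (fun _ => r) x) :
    eLpNorm u q ν ≤ ENNReal.ofReal a + ENNReal.ofReal b * eLpNorm s q ν +
      ENNReal.ofReal r * ν E ^ (1 / q.toReal) := by
  have hbs : Measurable (b • s) := hs.const_smul b
  have ha' : AEStronglyMeasurable (fun _ : α => a) ν := aestronglyMeasurable_const
  have hE' : AEStronglyMeasurable (E.indicator fun _ => r) ν :=
    (measurable_const.indicator hE).aestronglyMeasurable
  calc eLpNorm u q ν ≤ eLpNorm ((fun _ => a) + b • s + E.indicator fun _ => r) q ν :=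
        eLpNorm_mono_ae_real h
    _ ≤ eLpNorm (fun _ => a) q ν + eLpNorm (b • s) q ν + eLpNorm (E.indicator fun _ => r) q ν :=
        (eLpNorm_add_le (ha'.add hbs.aestronglyMeasurable) hE' hq).trans
          (add_le_add (eLpNorm_add_le ha' hbs.aestronglyMeasurable hq) le_rfl)
    _ ≤ _ := by
        gcongr
        · refine (eLpNorm_le_of_ae_bound (C := a) (Eventually.of_forall fun x => ?_)).trans
            (mul_le_of_le_one_left' (ENNReal.rpow_le_one hν (by positivity)))
          rw [Real.norm_of_nonneg ha]
        · rw [eLpNorm_const_smul, Real.enorm_eq_ofReal hb]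
        · refine (eLpNorm_indicator_const_le r q).trans ?_
          rw [Real.enorm_eq_ofReal hr]

namespace IsDoubling

variable {n : ℕ} {μ : Measure (Fin n → ℝ)} {c d : ℝ}

theorem abs_cubeAvg_le (hμ : IsDoubling μ c d) {f : (Fin n → ℝ) → ℝ}
    (hf : LocallyIntegrable f μ) {M : ℝ} (hM : ∀ x, |f x| ≤ M) (Q : Cube n) :
    |cubeAvg μ Q f| ≤ M := by
  have := hμ.isLocallyFiniteMeasure
  have h := hμ.abs_cubeAvg_sub_mul_le hf 0 Q
  simp only [sub_zero] at h
  refine le_of_mul_le_mul_right (h.trans ?_) (hμ.measureReal_pos Q)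
  refine (setIntegral_mono (hf.integrableOn_isCompact Q.isCompact_carrier).abs
    ((locallyIntegrable_const M).integrableOn_isCompact Q.isCompact_carrier) hM).trans ?_
  rw [setIntegral_const, smul_eq_mul, mul_comm]

variable {m : Cube n → Measure (Fin n → ℝ)} {q : ℝ≥0∞} {f : (Fin n → ℝ) → ℝ}

theorem eLpNorm_sub_cubeAvg_le (hμ : IsDoubling μ c d) (hm1 : ∀ Q, m Q univ ≤ 1)
    (hf : LocallyIntegrable f μ) {M : ℝ} (hM : ∀ x, |f x| ≤ M) (Q : Cube n) :
    eLpNorm (fun x => f x - cubeAvg μ Q f) q (m Q) ≤ ENNReal.ofReal (2 * M) := by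
  refine (eLpNorm_le_of_ae_bound (C := 2 * M) (Eventually.of_forall fun x => ?_)).trans ?_
  · rw [Real.norm_eq_abs, two_mul]
    exact (abs_sub _ _).trans (add_le_add (hM x) (hμ.abs_cubeAvg_le hf hM Q))
  · exact mul_le_of_le_one_left' (ENNReal.rpow_le_one (hm1 Q) (by positivity))

/-- The self-improving estimate for the supremum over all cubes of the `L^q` oscillations of a
bounded function, up to a small error. -/
theorem eLpNorm_sub_cubeAvg_le_add_iSup (hμ : IsDoubling μ c d)
    (hm1 : ∀ Q, m Q univ ≤ 1) (hac : ∀ Q, m Q ≪ μ) (hsupp : ∀ Q, ∀ᵐ x ∂m Q, x ∈ Q.carrier)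
    (hmono : ∀ Q R : Cube n, R.carrier ⊆ Q.carrier → ∀ P : (Fin n → ℝ) → Prop,
      (∀ᵐ x ∂m R, P x) → ∀ᵐ x ∂m Q, x ∈ R.carrier → P x)
    (hq : 1 ≤ q) (hqt : q ≠ ⊤) {L θ : ℝ} (hL : 1 < L)
    (hA : ∀ (Q : Cube n) (T : Finset (Cube n)), (∀ R ∈ T, R.carrier ⊆ Q.carrier) →
      (T : Set (Cube n)).PairwiseDisjoint Cube.carrier →
      μ.real (⋃ R ∈ T, R.carrier) ≤ μ.real Q.carrier / L →
      ∀ h : Cube n → (Fin n → ℝ) → ℝ,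
        (∀ R ∈ T, (∀ x, 0 ≤ h R x) ∧ Measurable (h R) ∧ eLpNorm (h R) q (m R) = 1) →
        eLpNorm (fun x => ∑ R ∈ T, R.carrier.indicator (h R) x) q (m Q) ≤ ENNReal.ofReal θ)
    (hfm : Measurable f) (hf : LocallyIntegrable f μ) {M : ℝ} (hM : ∀ x, |f x| ≤ M)
    {B : ℝ} (hB : 0 < B) (hosc : ∀ Q, osc μ Q f ≤ B) (Q : Cube n) :
    eLpNorm (fun x => f x - cubeAvg μ Q f) q (m Q) ≤
      ENNReal.ofReal ((c * 2 ^ d + 1) * (L * B)) +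
        (⨆ R, eLpNorm (fun x => f x - cubeAvg μ R f) q (m R)) * ENNReal.ofReal θ := by
  classical
  set N : Cube n → ℝ≥0∞ := fun R => eLpNorm (fun x => f x - cubeAvg μ R f) q (m R)
  have hNfin : ∀ R, N R ≠ ⊤ := fun R =>
    ((hμ.eLpNorm_sub_cubeAvg_le hm1 hf hM R).trans_lt ENNReal.ofReal_lt_top).ne
  set X : ℝ≥0∞ := ⨆ R, N R
  have hXfin : X ≠ ⊤ :=
    ((iSup_le fun R => hμ.eLpNorm_sub_cubeAvg_le hm1 hf hM R).trans_lt ENNReal.ofReal_lt_top).ne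
  have hc : 0 ≤ c * 2 ^ d := by have := hμ.1; positivity
  have : IsFiniteMeasure (m Q) := ⟨(hm1 Q).trans_lt ENNReal.one_lt_top⟩
  have hM0 : 0 ≤ M := (abs_nonneg _).trans (hM 0)
  set Λ := (c * 2 ^ d + 1) * (L * B)
  have hLB : 0 < L * B := by positivity
  have hΛ0 : 0 ≤ Λ := by positivity
  have main : ∀ ε : ℝ≥0∞, 0 < ε → N Q ≤ ENNReal.ofReal Λ + X * ENNReal.ofReal θ +
      ENNReal.ofReal (2 * M) * ε ^ (1 / q.toReal) := by
    intro ε hε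
    obtain ⟨T, bad, hTQ, hTd, hTμ, hTavg, hbad, hcov⟩ :=
      hμ.exists_sparse_cubes hfm hf hL hB Q (hosc Q) (m Q) (hac Q) hε
    set bad' := toMeasurable (m Q) bad
    have hbad' : m Q bad' ≤ ε := by rwa [measure_toMeasurable]
    set T' := T.filter fun R => N R ≠ 0
    have hT'T : T' ⊆ T := Finset.filter_subset _ _
    set h : Cube n → (Fin n → ℝ) → ℝ := fun R x => (N R).toReal⁻¹ * |f x - cubeAvg μ R f| with hh
    have hh0 : ∀ R x, 0 ≤ h R x := fun R x => by positivity
    have hhm : ∀ R, Measurable (h R) := fun R => (hfm.sub_const _).abs.const_mul _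
    have hh1 : ∀ R ∈ T', eLpNorm (h R) q (m R) = 1 := by
      intro R hR
      have hR0 : N R ≠ 0 := (Finset.mem_filter.1 hR).2
      have h1 : h R = (N R).toReal⁻¹ • fun x => ‖f x - cubeAvg μ R f‖ := rfl
      rw [h1, eLpNorm_const_smul, eLpNorm_norm, Real.enorm_eq_ofReal (by positivity),
        ENNReal.ofReal_inv_of_pos (ENNReal.toReal_pos hR0 (hNfin R)),
        ENNReal.ofReal_toReal (hNfin R)]
      exact ENNReal.inv_mul_cancel hR0 (hNfin R)
    set s : (Fin n → ℝ) → ℝ := fun x => ∑ R ∈ T', R.carrier.indicator (h R) x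
    have hsm : Measurable s := Finset.measurable_sum _ fun R _ =>
      (hhm R).indicator R.measurableSet_carrier
    have hs0 : ∀ x, 0 ≤ s x := fun x =>
      Finset.sum_nonneg fun R _ => indicator_nonneg (fun y _ => hh0 R y) x
    have hsle : eLpNorm s q (m Q) ≤ ENNReal.ofReal θ := by
      refine hA Q T' (fun R hR => hTQ R (hT'T hR)) (hTd.subset (by exact_mod_cast hT'T))
        (le_trans (measureReal_mono (biUnion_subset_biUnion_left fun R hR => hT'T hR) ?_) hTμ) h
        fun R hR => ⟨hh0 R, hhm R, hh1 R hR⟩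
      exact ((measure_mono (iUnion₂_subset hTQ)).trans_lt (hμ.2.2.1 Q).2).ne
    have hzero : ∀ᵐ x ∂m Q, ∀ R ∈ T, N R = 0 → x ∈ R.carrier → f x - cubeAvg μ R f = 0 := by
      rw [Finset.eventually_all]
      intro R hR
      by_cases hR0 : N R = 0
      · have h1 := (eLpNorm_eq_zero_iff (hfm.sub_const _).aestronglyMeasurable
          (one_pos.trans_le hq).ne').1 hR0
        filter_upwards [hmono Q R (hTQ R hR) _ h1] with x hx _ hxR using hx hxR
      · exact Eventually.of_forall fun x h => absurd h hR0
    have hpt : ∀ᵐ x ∂m Q, ‖f x - cubeAvg μ Q f‖ ≤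
        Λ + X.toReal * s x + bad'.indicator (fun _ => 2 * M) x := by
      filter_upwards [hsupp Q, hzero] with x hxQ hx0
      rw [Real.norm_eq_abs]
      have hX0 : 0 ≤ X.toReal * s x := mul_nonneg ENNReal.toReal_nonneg (hs0 x)
      have hi0 : 0 ≤ bad'.indicator (fun _ => 2 * M) x :=
        indicator_nonneg (fun _ _ => by positivity) x
      rcases hcov x hxQ with h1 | h1 | ⟨R, hR, hxR⟩
      · have : L * B ≤ Λ := le_mul_of_one_le_left hLB.le (by linarith)
        linarith
      · rw [indicator_of_mem (subset_toMeasurable _ _ h1)]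
        have := (abs_sub (f x) (cubeAvg μ Q f)).trans
          (add_le_add (hM x) (hμ.abs_cubeAvg_le hf hM Q))
        linarith
      · have h2 : |f x - cubeAvg μ Q f| ≤
            |f x - cubeAvg μ R f| + |cubeAvg μ R f - cubeAvg μ Q f| := abs_sub_le _ _ _
        have h3 := hTavg R hR
        have h4 : |f x - cubeAvg μ R f| ≤ X.toReal * s x := by
          by_cases hR0 : N R = 0
          · rw [hx0 R hR hR0 hxR, abs_zero]; exact hX0
          · have h5 : h R x ≤ s x := by
              have := Finset.single_le_sum (f := fun R => R.carrier.indicator (h R) x)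
                (fun R _ => indicator_nonneg (fun y _ => hh0 R y) x)
                (Finset.mem_filter.2 ⟨hR, hR0⟩ : R ∈ T')
              simpa only [indicator_of_mem hxR] using this
            have hNpos := ENNReal.toReal_pos hR0 (hNfin R)
            calc |f x - cubeAvg μ R f| = (N R).toReal * h R x := by
                  simp only [hh]; field_simp
              _ ≤ X.toReal * s x :=
                mul_le_mul (ENNReal.toReal_mono hXfin (le_iSup N R)) h5 (hh0 R x)
                  ENNReal.toReal_nonneg
        linarith
    refine (eLpNorm_le_of_ae_le_const_add (hm1 Q) hq hsm hΛ0 ENNReal.toReal_nonneg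
      (by positivity) (measurableSet_toMeasurable _ _) hpt).trans ?_
    rw [ENNReal.ofReal_toReal hXfin]
    gcongr
  have hlim : Tendsto (fun ε : ℝ≥0∞ => ENNReal.ofReal Λ + X * ENNReal.ofReal θ +
      ENNReal.ofReal (2 * M) * ε ^ (1 / q.toReal)) (nhdsWithin 0 (Set.Ioi 0))
      (nhds (ENNReal.ofReal Λ + X * ENNReal.ofReal θ +
        ENNReal.ofReal (2 * M) * 0 ^ (1 / q.toReal))) := by
    refine Tendsto.mono_left ?_ nhdsWithin_le_nhds
    exact tendsto_const_nhds.add (ENNReal.Tendsto.const_mul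
      (ENNReal.continuous_rpow_const.tendsto 0) (Or.inr ENNReal.ofReal_ne_top))
  have hq0 : 0 < q.toReal := ENNReal.toReal_pos (one_pos.trans_le hq).ne' hqt
  rw [ENNReal.zero_rpow_of_pos (by positivity), mul_zero, add_zero] at hlim
  exact ge_of_tendsto hlim (by filter_upwards [self_mem_nhdsWithin] with ε hε using main ε hε)

/-- The `L^q` oscillation of a bounded function is controlled by its mean oscillation. -/
theorem eLpNorm_sub_cubeAvg_le_of_osc_le (hμ : IsDoubling μ c d)
    (hm1 : ∀ Q, m Q univ ≤ 1) (hac : ∀ Q, m Q ≪ μ) (hsupp : ∀ Q, ∀ᵐ x ∂m Q, x ∈ Q.carrier)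
    (hmono : ∀ Q R : Cube n, R.carrier ⊆ Q.carrier → ∀ P : (Fin n → ℝ) → Prop,
      (∀ᵐ x ∂m R, P x) → ∀ᵐ x ∂m Q, x ∈ R.carrier → P x)
    (hq : 1 ≤ q) (hqt : q ≠ ⊤) {L θ : ℝ} (hL : 1 < L) (hθ0 : 0 ≤ θ) (hθ : θ < 1)
    (hA : ∀ (Q : Cube n) (T : Finset (Cube n)), (∀ R ∈ T, R.carrier ⊆ Q.carrier) →
      (T : Set (Cube n)).PairwiseDisjoint Cube.carrier →
      μ.real (⋃ R ∈ T, R.carrier) ≤ μ.real Q.carrier / L →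
      ∀ h : Cube n → (Fin n → ℝ) → ℝ,
        (∀ R ∈ T, (∀ x, 0 ≤ h R x) ∧ Measurable (h R) ∧ eLpNorm (h R) q (m R) = 1) →
        eLpNorm (fun x => ∑ R ∈ T, R.carrier.indicator (h R) x) q (m Q) ≤ ENNReal.ofReal θ)
    (hfm : Measurable f) (hf : LocallyIntegrable f μ) {M : ℝ} (hM : ∀ x, |f x| ≤ M)
    {B : ℝ} (hB : 0 < B) (hosc : ∀ Q, osc μ Q f ≤ B) (Q : Cube n) :
    eLpNorm (fun x => f x - cubeAvg μ Q f) q (m Q) ≤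
      ENNReal.ofReal ((c * 2 ^ d + 1) * (L / (1 - θ)) * B) := by
  set X := ⨆ R, eLpNorm (fun x => f x - cubeAvg μ R f) q (m R) with hX
  have hXfin : X ≠ ⊤ :=
    ((iSup_le fun R => hμ.eLpNorm_sub_cubeAvg_le hm1 hf hM R).trans_lt ENNReal.ofReal_lt_top).ne
  have hXle : X ≤ ENNReal.ofReal ((c * 2 ^ d + 1) * (L * B)) + X * ENNReal.ofReal θ :=
    iSup_le fun R => hμ.eLpNorm_sub_cubeAvg_le_add_iSup hm1 hac hsupp hmono hq hqt hL hA hfm hf hM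
      hB hosc R
  have hc : 0 ≤ c * 2 ^ d := by have := hμ.1; positivity
  have h0 : 0 ≤ (c * 2 ^ d + 1) * (L * B) := by positivity
  refine (le_iSup (fun R => eLpNorm (fun x => f x - cubeAvg μ R f) q (m R)) Q).trans ?_
  rw [← hX, ENNReal.le_ofReal_iff_toReal_le hXfin
    (by have := sub_pos.2 hθ; positivity)]
  rw [← ENNReal.ofReal_toReal hXfin, ← ENNReal.ofReal_mul ENNReal.toReal_nonneg,
    ← ENNReal.ofReal_add h0 (by positivity), ENNReal.ofReal_le_ofReal_iff (by positivity)] at hXle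
  have : (c * 2 ^ d + 1) * (L / (1 - θ)) * B = (c * 2 ^ d + 1) * (L * B) / (1 - θ) := by ring
  rw [this, le_div_iff₀ (sub_pos.2 hθ)]
  linarith

end IsDoubling

/-- The measure `w dμ / Y(Q)` on the cube `Q`. -/
def Cube.weightMeasure {n : ℕ} (μ : Measure (Fin n → ℝ)) (w : (Fin n → ℝ) → ℝ) (Y : Cube n → ℝ)
    (Q : Cube n) : Measure (Fin n → ℝ) :=
  (ENNReal.ofReal (Y Q))⁻¹ • (μ.withDensity fun x => ENNReal.ofReal (w x)).restrict Q.carrier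

section weightMeasure

variable {n : ℕ} {μ : Measure (Fin n → ℝ)} {w : (Fin n → ℝ) → ℝ} {Y : Cube n → ℝ}

theorem Cube.weightMeasure_absolutelyContinuous (Q : Cube n) : Q.weightMeasure μ w Y ≪ μ :=
  (Measure.smul_absolutelyContinuous.trans
    Measure.restrict_le_self.absolutelyContinuous).trans (withDensity_absolutelyContinuous _ _)

theorem Cube.ae_weightMeasure_mem (Q : Cube n) : ∀ᵐ x ∂(Q.weightMeasure μ w Y), x ∈ Q.carrier :=
  Measure.ae_smul_measure (ae_restrict_mem Q.measurableSet_carrier) _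

theorem Cube.ae_weightMeasure_mono (Q R : Cube n) (P : (Fin n → ℝ) → Prop)
    (h : ∀ᵐ x ∂(R.weightMeasure μ w Y), P x) :
    ∀ᵐ x ∂(Q.weightMeasure μ w Y), x ∈ R.carrier → P x := by
  have h0 : (ENNReal.ofReal (Y R))⁻¹ ≠ 0 := ENNReal.inv_ne_zero.2 ENNReal.ofReal_ne_top
  rw [Cube.weightMeasure, Measure.ae_ennreal_smul_measure_iff h0,
    ae_restrict_iff' R.measurableSet_carrier] at h
  exact Measure.ae_smul_measure (ae_restrict_of_ae h) _

theorem Cube.weightMeasure_univ_le (Q : Cube n) (hw0 : ∀ x, 0 ≤ w x)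
    (hwloc : LocallyIntegrable w μ) (hY : 0 < Y Q) (hdom : ∫ x in Q.carrier, w x ∂μ ≤ Y Q) :
    Q.weightMeasure μ w Y univ ≤ 1 := by
  rw [Cube.weightMeasure, Measure.smul_apply, Measure.restrict_apply_univ,
    withDensity_apply _ Q.measurableSet_carrier, smul_eq_mul,
    ← ofReal_integral_eq_lintegral_ofReal (hwloc.integrableOn_isCompact Q.isCompact_carrier)
      (Eventually.of_forall hw0)]
  calc _ ≤ (ENNReal.ofReal (Y Q))⁻¹ * ENNReal.ofReal (Y Q) := by gcongr
    _ = 1 := ENNReal.inv_mul_cancel (by simpa using hY) ENNReal.ofReal_ne_top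

theorem YLpNorm_eq_eLpNorm (hw : AEMeasurable w μ) {p : ℝ} (hp : 1 ≤ p)
    {f : (Fin n → ℝ) → ℝ} (hf : AEMeasurable f μ) (Q : Cube n) :
    YLpNorm μ w Y p Q f = eLpNorm f (ENNReal.ofReal p) (Q.weightMeasure μ w Y) := by
  have hp0 : 0 < p := one_pos.trans_le hp
  rw [eLpNorm_eq_lintegral_rpow_enorm_toReal (by simpa using hp0) ENNReal.ofReal_ne_top,
    ENNReal.toReal_ofReal hp0.le, YLpNorm, Cube.weightMeasure, lintegral_smul_measure,
    restrict_withDensity Q.measurableSet_carrier,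
    lintegral_withDensity_eq_lintegral_mul₀ hw.restrict.ennreal_ofReal
      (hf.restrict.enorm.pow_const p), smul_eq_mul, ENNReal.div_eq_inv_mul]
  congr 3 with x
  rw [Pi.mul_apply, ENNReal.ofReal_mul (by positivity), mul_comm,
    ← ENNReal.ofReal_rpow_of_nonneg (abs_nonneg _) hp0.le, Real.enorm_eq_ofReal_abs]

/-- The indexing of a disjoint family by natural numbers can be replaced by a finite set. -/
theorem YLpNorm_sum_indicator_le {p : ℝ} {Φ : ℝ → ℝ} {Q : Cube n}
    (hA : ∀ (J : Set ℕ) (Qj : ℕ → Cube n),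
      (∀ j ∈ J, (Qj j).carrier ⊆ Q.carrier) →
      (J.Pairwise fun i j => Disjoint (Qj i).carrier (Qj j).carrier) →
      ∀ h : ℕ → (Fin n → ℝ) → ℝ,
        (∀ j ∈ J, (∀ x, 0 ≤ h j x) ∧ Measurable (h j) ∧ YLpNorm μ w Y p (Qj j) (h j) = 1) →
        YLpNorm μ w Y p Q
            (fun x => ∑' j : J, Set.indicator (Qj (j : ℕ)).carrier (h (j : ℕ)) x) ≤
          ENNReal.ofReal (Φ ((μ (⋃ j ∈ J, (Qj j).carrier)).toReal / (μ Q.carrier).toReal)))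
    (T : Finset (Cube n)) (hT : ∀ R ∈ T, R.carrier ⊆ Q.carrier)
    (hTd : (T : Set (Cube n)).PairwiseDisjoint Cube.carrier) (h : Cube n → (Fin n → ℝ) → ℝ)
    (hh : ∀ R ∈ T, (∀ x, 0 ≤ h R x) ∧ Measurable (h R) ∧ YLpNorm μ w Y p R (h R) = 1) :
    YLpNorm μ w Y p Q (fun x => ∑ R ∈ T, R.carrier.indicator (h R) x) ≤
      ENNReal.ofReal (Φ (μ.real (⋃ R ∈ T, R.carrier) / μ.real Q.carrier)) := by
  have : Nonempty (Cube n) := ⟨Q⟩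
  obtain ⟨e, he⟩ := countable_iff_exists_injOn.1 T.countable_toSet
  set u := Function.invFunOn e (T : Set (Cube n))
  have hu : ∀ R ∈ T, u (e R) = R := fun R hR => he.leftInvOn_invFunOn hR
  have key := hA (e '' T) u ?_ ?_ (fun j => h (u j)) ?_
  · have h1 : ∀ x, ∑' j : (e '' (T : Set (Cube n)) : Set ℕ),
        Set.indicator (u (j : ℕ)).carrier (h (u (j : ℕ))) x =
        ∑ R ∈ T, R.carrier.indicator (h R) x := by
      intro x
      rw [tsum_image (fun j => Set.indicator (u j).carrier (h (u j)) x) he]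
      refine (Finset.tsum_subtype T fun R =>
        Set.indicator (u (e R)).carrier (h (u (e R))) x).trans ?_
      exact Finset.sum_congr rfl fun R hR => by rw [hu R hR]
    have h2 : ⋃ j ∈ e '' (T : Set (Cube n)), (u j).carrier = ⋃ R ∈ T, R.carrier := by
      rw [biUnion_image]
      exact iUnion₂_congr fun R hR => by rw [hu R hR]
    simp only [h1, h2] at key
    exact key
  · rintro _ ⟨R, hR, rfl⟩
    rw [hu R hR]; exact hT R hR
  · rintro _ ⟨R, hR, rfl⟩ _ ⟨R', hR', rfl⟩ hne
    rw [hu R hR, hu R' hR']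
    exact hTd hR hR' fun h => hne (by rw [h])
  · rintro _ ⟨R, hR, rfl⟩
    simp only [hu R hR]
    exact hh R hR

end weightMeasure

namespace IsDoubling

variable {n : ℕ} {μ : Measure (Fin n → ℝ)} {c d : ℝ}

/-- Mean oscillations are twice the mean of the part above the average, and of the part below. -/
theorem integral_abs_sub_cubeAvg_eq (hμ : IsDoubling μ c d) {f : (Fin n → ℝ) → ℝ}
    (hf : LocallyIntegrable f μ) (Q : Cube n) :
    ∫ x in Q.carrier, |f x - cubeAvg μ Q f| ∂μ =
        2 * ∫ x in Q.carrier, max (f x - cubeAvg μ Q f) 0 ∂μ ∧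
      ∫ x in Q.carrier, |f x - cubeAvg μ Q f| ∂μ =
        2 * ∫ x in Q.carrier, max (cubeAvg μ Q f - f x) 0 ∂μ := by
  have := hμ.isLocallyFiniteMeasure
  set a := cubeAvg μ Q f with ha
  have hpos := hμ.measureReal_pos Q
  have hi : IntegrableOn (fun x => f x - a) Q.carrier μ :=
    (hf.sub (locallyIntegrable_const a)).integrableOn_isCompact Q.isCompact_carrier
  have h0 : ∫ x in Q.carrier, (f x - a) ∂μ = 0 := by
    rw [integral_sub (hf.integrableOn_isCompact Q.isCompact_carrier)
      ((locallyIntegrable_const a).integrableOn_isCompact Q.isCompact_carrier),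
      setIntegral_const, smul_eq_mul, ha, cubeAvg, setAverage_eq, smul_eq_mul]
    field_simp
    simp
  constructor
  · have : ∀ x, |f x - a| = 2 * max (f x - a) 0 - (f x - a) := fun x => by
      rcases le_total (f x - a) 0 with h | h
      · rw [abs_of_nonpos h, max_eq_right h]; ring
      · rw [abs_of_nonneg h, max_eq_left h]; ring
    simp only [this]
    rw [integral_sub (hi.pos_part.const_mul 2) hi, h0, sub_zero, integral_const_mul]
  · have : ∀ x, |f x - a| = 2 * max (a - f x) 0 + (f x - a) := fun x => by
      rcases le_total (f x - a) 0 with h | h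
      · rw [abs_of_nonpos h, max_eq_left (by linarith)]; ring
      · rw [abs_of_nonneg h, max_eq_right (by linarith)]; ring
    have hn : IntegrableOn (fun x => max (a - f x) 0) Q.carrier μ := by
      simpa [IntegrableOn] using hi.neg_part
    simp only [this]
    rw [integral_add (hn.const_mul 2) hi, h0, add_zero, integral_const_mul]

/-- Composition with a nondecreasing contraction does not increase mean oscillations. -/
theorem osc_comp_le (hμ : IsDoubling μ c d) {f : (Fin n → ℝ) → ℝ}
    (hf : LocallyIntegrable f μ) {φ : ℝ → ℝ} (hφ : Monotone φ)
    (hφ1 : ∀ s t, s ≤ t → φ t - φ s ≤ t - s) (hφf : LocallyIntegrable (fun x => φ (f x)) μ)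
    (Q : Cube n) (hr : ∃ a, φ a = cubeAvg μ Q (fun x => φ (f x))) :
    osc μ Q (fun x => φ (f x)) ≤ osc μ Q f := by
  have := hμ.isLocallyFiniteMeasure
  refine le_of_mul_le_mul_right ?_ (hμ.measureReal_pos Q)
  rw [← hμ.integral_eq_osc_mul, ← hμ.integral_eq_osc_mul]
  obtain ⟨a, ha⟩ := hr
  obtain ⟨f1, f2⟩ := hμ.integral_abs_sub_cubeAvg_eq hf Q
  obtain ⟨g1, g2⟩ := hμ.integral_abs_sub_cubeAvg_eq hφf Q
  have hint : ∀ {g : (Fin n → ℝ) → ℝ} (_ : LocallyIntegrable g μ) (b : ℝ),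
      IntegrableOn (fun x => max (g x - b) 0) Q.carrier μ ∧
      IntegrableOn (fun x => max (b - g x) 0) Q.carrier μ := fun {g} hg b =>
    ⟨((hg.sub (locallyIntegrable_const b)).integrableOn_isCompact Q.isCompact_carrier).pos_part,
     (((locallyIntegrable_const b).sub hg).integrableOn_isCompact Q.isCompact_carrier).pos_part⟩
  rcases le_total (cubeAvg μ Q f) a with h | h
  · rw [f1, g1]
    gcongr ?_ * ?_
    refine integral_mono (hint hφf _).1 (hint hf _).1 fun x => ?_
    refine max_le ?_ (le_max_right _ _)
    rw [← ha]
    rcases le_total (f x) a with h' | h'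
    · exact le_max_of_le_right (sub_nonpos.2 (hφ h'))
    · exact le_max_of_le_left ((hφ1 _ _ h').trans (by linarith))
  · rw [f2, g2]
    gcongr ?_ * ?_
    refine integral_mono (hint hφf _).2 (hint hf _).2 fun x => ?_
    refine max_le ?_ (le_max_right _ _)
    rw [← ha]
    rcases le_total (f x) a with h' | h'
    · exact le_max_of_le_left ((hφ1 _ _ h').trans (by linarith))
    · exact le_max_of_le_right (sub_nonpos.2 (hφ h'))

end IsDoubling

theorem tendsto_clamp_natCast (t : ℝ) :
    Tendsto (fun N : ℕ => max (-(N : ℝ)) (min t N)) atTop (nhds t) := by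
  refine tendsto_const_nhds.congr' ?_
  filter_upwards [tendsto_natCast_atTop_atTop.eventually_ge_atTop |t|] with N hN
  rw [min_eq_left (abs_le.1 hN).2, max_eq_right (abs_le.1 hN).1]

theorem abs_clamp_le (t : ℝ) {M : ℝ} (hM : 0 ≤ M) : |max (-M) (min t M)| ≤ |t| := by
  rcases abs_cases t with h | h <;>
  rcases max_cases (-M) (min t M) with h' | h' <;>
  rcases min_cases t M with h'' | h'' <;>
  exact abs_le.2 ⟨by linarith, by linarith⟩

namespace IsDoubling

variable {n : ℕ} {μ : Measure (Fin n → ℝ)} {c d : ℝ}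

theorem osc_clamp_le (hμ : IsDoubling μ c d) {f : (Fin n → ℝ) → ℝ} (hfm : Measurable f)
    (hf : LocallyIntegrable f μ) {M : ℝ} (hM : 0 ≤ M) :
    LocallyIntegrable (fun x => max (-M) (min (f x) M)) μ ∧
      ∀ Q, osc μ Q (fun x => max (-M) (min (f x) M)) ≤ osc μ Q f := by
  have habs : ∀ x, |max (-M) (min (f x) M)| ≤ M := fun x =>
    abs_le.2 ⟨le_max_left _ _, max_le (by linarith) (min_le_right _ _)⟩
  have hint : LocallyIntegrable (fun x => max (-M) (min (f x) M)) μ := by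
    refine hf.mono (measurable_const.max (hfm.min measurable_const)).aestronglyMeasurable
      (Eventually.of_forall fun x => ?_)
    exact abs_clamp_le (f x) hM
  refine ⟨hint, fun Q => hμ.osc_comp_le (φ := fun t => max (-M) (min t M)) hf ?_ ?_ hint Q
    ⟨cubeAvg μ Q fun x => max (-M) (min (f x) M), ?_⟩⟩
  · exact fun s t h => max_le_max le_rfl (min_le_min h le_rfl)
  · intro s t h
    rcases max_cases (-M) (min s M) with h1 | h1 <;>
    rcases min_cases s M with h2 | h2 <;>
    rcases max_cases (-M) (min t M) with h3 | h3 <;>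
    rcases min_cases t M with h4 | h4 <;>
    simp only [h1.1, h3.1] <;> linarith
  · have := abs_le.1 (hμ.abs_cubeAvg_le hint habs Q)
    rw [min_eq_left this.2, max_eq_right this.1]

theorem tendsto_cubeAvg_clamp {f : (Fin n → ℝ) → ℝ} (hfm : Measurable f)
    (hf : LocallyIntegrable f μ) (Q : Cube n) :
    Tendsto (fun N : ℕ => cubeAvg μ Q fun x => max (-(N : ℝ)) (min (f x) N)) atTop
      (nhds (cubeAvg μ Q f)) := by
  simp only [cubeAvg, setAverage_eq]
  refine Tendsto.const_smul ?_ _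
  refine tendsto_integral_of_dominated_convergence (fun x => |f x|)
    (fun N => (measurable_const.max (hfm.min measurable_const)).aestronglyMeasurable)
    (hf.integrableOn_isCompact Q.isCompact_carrier).abs
    (fun N => Eventually.of_forall fun x => ?_) (Eventually.of_forall fun x => ?_)
  · exact abs_clamp_le (f x) N.cast_nonneg
  · exact tendsto_clamp_natCast (f x)

end IsDoubling

/-- Theorem 1.1 specialized to the weighted `L^p` scale: if `Y` is an
`A_∞(dμ, L^p(w))` functional (with constant `C_Y` and increasing bijection `Ψ` of
`[0,1]`, with inverse `Ψinv`) which dominates `w`, then for every `f ∈ BMO(dμ)`, every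
cube `Q` and every `L > max{1, 1/Ψ(1/C_Y)}`,
`((1/Y(Q)) ∫_Q |f − f_{Q,μ}|^p w dμ)^{1/p}
  ≤ (c_μ 2^{n_μ} + 1) (L/(1 − C_Y Ψ⁻¹(1/L))) ‖f‖_{BMO(dμ)}`. -/
theorem statement18 {n : ℕ} (μ : Measure (Fin n → ℝ)) (c d : ℝ) (hμ : IsDoubling μ c d)
    (w : (Fin n → ℝ) → ℝ) (hw0 : ∀ x, 0 ≤ w x) (hwloc : LocallyIntegrable w μ)
    (p : ℝ) (hp : 1 ≤ p)
    (Y : Cube n → ℝ) (hY : ∀ Q : Cube n, 0 < Y Q)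
    (hdom : ∀ Q : Cube n, ∫ x in Q.carrier, w x ∂μ ≤ Y Q)
    (CY : ℝ) (hCY : 0 < CY) (Ψ Ψinv : ℝ → ℝ)
    (hmono : StrictMonoOn Ψ (Set.Icc 0 1))
    (hbij : Set.BijOn Ψ (Set.Icc 0 1) (Set.Icc 0 1))
    (hinv : ∀ t ∈ Set.Icc (0 : ℝ) 1, Ψinv t ∈ Set.Icc (0 : ℝ) 1 ∧ Ψ (Ψinv t) = t)
    (hAinfty : ∀ (Q : Cube n) (J : Set ℕ) (Qj : ℕ → Cube n),
      (∀ j ∈ J, (Qj j).carrier ⊆ Q.carrier) →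
      (J.Pairwise fun i j => Disjoint (Qj i).carrier (Qj j).carrier) →
      ∀ h : ℕ → (Fin n → ℝ) → ℝ,
        (∀ j ∈ J, (∀ x, 0 ≤ h j x) ∧ Measurable (h j) ∧ YLpNorm μ w Y p (Qj j) (h j) = 1) →
        YLpNorm μ w Y p Q
            (fun x => ∑' j : J, Set.indicator (Qj (j : ℕ)).carrier (h (j : ℕ)) x) ≤
          ENNReal.ofReal (CY *
            Ψinv ((μ (⋃ j ∈ J, (Qj j).carrier)).toReal / (μ Q.carrier).toReal))) :
    ∀ f : (Fin n → ℝ) → ℝ, MemBMO μ f → ∀ Q : Cube n,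
    ∀ L : ℝ, max 1 (1 / Ψ (1 / CY)) < L →
      YLpNorm μ w Y p Q (fun x => f x - cubeAvg μ Q f) ≤
        ENNReal.ofReal ((c * 2 ^ d + 1) * (L / (1 - CY * Ψinv (1 / L))) * bmoNorm μ f) := by
  intro f hf Q L hL
  obtain ⟨hf, hbdd⟩ := hf
  have hL1 : 1 < L := (le_max_left _ _).trans_lt hL
  have hL0 : 0 < L := one_pos.trans hL1
  have hLI : 1 / L ∈ Set.Icc (0 : ℝ) 1 := ⟨by positivity, by rw [div_le_one hL0]; exact hL1.le⟩
  obtain ⟨hΨI, hΨΨ⟩ := hinv _ hLI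
  set θ := CY * Ψinv (1 / L)
  have hθ0 : 0 ≤ θ := mul_nonneg hCY.le hΨI.1
  have hθ1 : θ < 1 := by
    by_contra! hcon
    have hle : 1 / CY ≤ Ψinv (1 / L) := by rw [div_le_iff₀ hCY, mul_comm]; exact hcon
    have hCYI : 1 / CY ∈ Set.Icc (0 : ℝ) 1 := ⟨by positivity, hle.trans hΨI.2⟩
    have h1 : Ψ (1 / CY) ≤ 1 / L := hΨΨ ▸ hmono.monotoneOn hCYI hΨI hle
    have h2 : 0 < Ψ (1 / CY) := (hbij.mapsTo (by simp)).1.trans_lt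
      (hmono (by simp) hCYI (show (0 : ℝ) < 1 / CY by positivity))
    have h3 : 1 / Ψ (1 / CY) < L := (le_max_right _ _).trans_lt hL
    rw [div_lt_iff₀ h2] at h3
    rw [le_div_iff₀ hL0] at h1
    linarith
  have hΨinv_mono : ∀ s ∈ Set.Icc (0 : ℝ) 1, s ≤ 1 / L → Ψinv s ≤ Ψinv (1 / L) := by
    intro s hs hsL
    obtain ⟨h1, h2⟩ := hinv s hs
    rwa [← hmono.le_iff_le h1 hΨI, h2, hΨΨ]
  have hq : 1 ≤ ENNReal.ofReal p := ENNReal.one_le_ofReal.2 hp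
  have hw := hwloc.aestronglyMeasurable.aemeasurable
  have hA : ∀ (Q : Cube n) (T : Finset (Cube n)), (∀ R ∈ T, R.carrier ⊆ Q.carrier) →
      (T : Set (Cube n)).PairwiseDisjoint Cube.carrier →
      μ.real (⋃ R ∈ T, R.carrier) ≤ μ.real Q.carrier / L →
      ∀ h : Cube n → (Fin n → ℝ) → ℝ,
        (∀ R ∈ T, (∀ x, 0 ≤ h R x) ∧ Measurable (h R) ∧
          eLpNorm (h R) (ENNReal.ofReal p) (R.weightMeasure μ w Y) = 1) →
        eLpNorm (fun x => ∑ R ∈ T, R.carrier.indicator (h R) x) (ENNReal.ofReal p)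
          (Q.weightMeasure μ w Y) ≤ ENNReal.ofReal θ := by
    intro Q T hT hTd hTμ h hh
    have hQpos := hμ.measureReal_pos Q
    rw [← YLpNorm_eq_eLpNorm hw hp (Finset.aemeasurable_fun_sum _ fun R hR =>
      ((hh R hR).2.1.indicator R.measurableSet_carrier).aemeasurable)]
    refine (YLpNorm_sum_indicator_le (Φ := fun t => CY * Ψinv t) (hAinfty Q) T hT hTd h
      fun R hR => ⟨(hh R hR).1, (hh R hR).2.1, ?_⟩).trans (ENNReal.ofReal_le_ofReal ?_)
    · rw [YLpNorm_eq_eLpNorm hw hp (hh R hR).2.1.aemeasurable]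
      exact (hh R hR).2.2
    · have hle : μ.real (⋃ R ∈ T, R.carrier) / μ.real Q.carrier ≤ 1 / L := by
        rw [div_le_iff₀ hQpos]
        exact hTμ.trans_eq (by ring)
      exact mul_le_mul_of_nonneg_left
        (hΨinv_mono _ ⟨by positivity, hle.trans hLI.2⟩ hle) hCY.le
  set g := hf.aestronglyMeasurable.mk f
  have hgm : Measurable g := hf.aestronglyMeasurable.stronglyMeasurable_mk.measurable
  have hfg : f =ᵐ[μ] g := hf.aestronglyMeasurable.ae_eq_mk
  have hg : LocallyIntegrable g μ := hf.congr hfg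
  have havg : ∀ R, cubeAvg μ R f = cubeAvg μ R g := fun R =>
    average_congr (ae_restrict_of_ae hfg)
  have hosc : ∀ R, osc μ R g ≤ bmoNorm μ f := by
    intro R
    refine le_trans (le_of_eq ?_) (le_ciSup hbdd R)
    refine average_congr (ae_restrict_of_ae ?_)
    filter_upwards [hfg] with x hx
    rw [hx, havg]
  have hbmo0 : 0 ≤ bmoNorm μ f := Real.iSup_nonneg fun R => by
    rw [osc, setAverage_eq, smul_eq_mul]
    exact mul_nonneg (by positivity) (integral_nonneg fun x => abs_nonneg _)
  rw [YLpNorm_eq_eLpNorm hw hp (hf.aestronglyMeasurable.aemeasurable.sub_const _),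
    eLpNorm_congr_ae (g := fun x => g x - cubeAvg μ Q g)
      (Q.weightMeasure_absolutelyContinuous.ae_le
        (hfg.mono fun x hx => by simp only [hx, havg]))]
  have hlim : Tendsto (fun B : ℝ => ENNReal.ofReal ((c * 2 ^ d + 1) * (L / (1 - θ)) * B))
      (nhdsWithin (bmoNorm μ f) (Set.Ioi (bmoNorm μ f)))
      (nhds (ENNReal.ofReal ((c * 2 ^ d + 1) * (L / (1 - θ)) * bmoNorm μ f))) :=
    ((ENNReal.continuous_ofReal.comp (continuous_const_mul _)).tendsto _).mono_left
      nhdsWithin_le_nhds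
  refine ge_of_tendsto hlim ?_
  filter_upwards [self_mem_nhdsWithin] with B hB
  have hB' : bmoNorm μ f < B := hB
  refine (Lp.eLpNorm_lim_le_liminf_eLpNorm
    (f := fun N : ℕ => fun x => max (-(N : ℝ)) (min (g x) N) -
      cubeAvg μ Q fun x => max (-(N : ℝ)) (min (g x) N))
    (fun N => ((measurable_const.max (hgm.min measurable_const)).sub_const _).aestronglyMeasurable)
    _ (Eventually.of_forall fun x =>
      (tendsto_clamp_natCast (g x)).sub (IsDoubling.tendsto_cubeAvg_clamp hgm hg Q))).trans ?_
  refine (liminf_le_liminf (v := fun _ => ENNReal.ofReal ((c * 2 ^ d + 1) * (L / (1 - θ)) * B))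
    (Eventually.of_forall fun N => ?_)).trans_eq (liminf_const _)
  have hN : (0 : ℝ) ≤ N := N.cast_nonneg
  obtain ⟨hint, hoscN⟩ := hμ.osc_clamp_le hgm hg hN
  exact hμ.eLpNorm_sub_cubeAvg_le_of_osc_le (m := Cube.weightMeasure μ w Y)
    (fun R => R.weightMeasure_univ_le hw0 hwloc (hY R) (hdom R))
    (fun R => R.weightMeasure_absolutelyContinuous) (fun R => R.ae_weightMeasure_mem)
    (fun R R' _ P h => R.ae_weightMeasure_mono R' P h) hq ENNReal.ofReal_ne_top hL1 hθ0 hθ1 hA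
    (measurable_const.max (hgm.min measurable_const)) hint (M := N)
    (fun x => abs_le.2 ⟨le_max_left _ _, max_le (by linarith) (min_le_right _ _)⟩)
    (hbmo0.trans_lt hB') (fun R => (hoscN R).trans ((hosc R).trans hB'.le)) Q

end
end
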